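/- Let (A, ∘) be a finite-dimensional Novikov algebra and r ∈ A⊗A. Then r is a solution of the Novikov Yang–Baxter equation in A, i.e. r₁₃∘r₂₃ + r₁₂⋆r₂₃ + r₁₃∘r₁₂ = 0, if and only if r̂(a*)∘r̂(b*) = r̂(L_{A,⋆}*(r̂(a*))b* + R_A*(r̂ᵗ(b*))a*) for all a*, b* ∈ A*. -/

import Mathlib

open TensorProduct


section Defs

variable {k : Type*} [Field k] [CharZero k]
variable {A : Type*} [AddCommGroup A] [Module k A]
variable {M : Type*} [AddCommGroup M] [Module k M]

/-- A bilinear operation satisfying the Novikov algebra axioms. -/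
def IsNovikov (mul : A →ₗ[k] A →ₗ[k] A) : Prop :=
  (∀ a b c : A, mul (mul a b) c - mul a (mul b c) = mul (mul b a) c - mul b (mul a c)) ∧
  (∀ a b c : A, mul (mul a b) c = mul (mul a c) b)

/-- `(M, l, r)` is a bimodule of the Novikov algebra `(A, mul)`. -/
def IsNovikovBimodule (mul : A →ₗ[k] A →ₗ[k] A)
    (l r : A →ₗ[k] Module.End k M) : Prop :=
  (∀ (a b : A) (v : M), l (mul a b - mul b a) v = l a (l b v) - l b (l a v)) ∧
  (∀ (a b : A) (v : M), l a (r b v) - r b (l a v) = r (mul a b) v - r b (r a v)) ∧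
  (∀ (a b : A) (v : M), l (mul a b) v = r b (l a v)) ∧
  (∀ (a b : A) (v : M), r a (r b v) = r b (r a v))

/-- `(M, mulM, l, r)` is an `A`-bimodule Novikov algebra over the Novikov algebra `(A, mulA)`. -/
def IsBimoduleNovikovAlgebra (mulA : A →ₗ[k] A →ₗ[k] A)
    (mulM : M →ₗ[k] M →ₗ[k] M) (l r : A →ₗ[k] Module.End k M) : Prop :=
  IsNovikov mulM ∧ IsNovikovBimodule mulA l r ∧
  (∀ (a : A) (v w : M), mulM (l a v) w - l a (mulM v w) = mulM (r a v) w - mulM v (l a w)) ∧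
  (∀ (a : A) (v w : M), r a (mulM v w) - mulM v (r a w) = r a (mulM w v) - mulM w (r a v)) ∧
  (∀ (a : A) (v w : M), mulM (l a v) w = mulM (l a w) v) ∧
  (∀ (a : A) (v w : M), r a (mulM v w) = mulM (r a v) w)

/-- O-operator of weight `lam` on `(A, mulA)` associated to the A-bimodule Novikov algebra
`(M, mulM, l, r)`. -/
def IsOOperator (mulA : A →ₗ[k] A →ₗ[k] A) (mulM : M →ₗ[k] M →ₗ[k] M)
    (l r : A →ₗ[k] Module.End k M) (lam : k) (α : M →ₗ[k] A) : Prop :=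
  ∀ u v : M, mulA (α u) (α v) = α (l (α u) v + r (α v) u + lam • mulM u v)

/-- Post-Novikov algebra axioms: `circ` is Novikov and the eight compatibility conditions hold,
where `lhd a b = a ◁ b` and `rhd a b = a ▷ b`. -/
def IsPostNovikov (circ lhd rhd : A →ₗ[k] A →ₗ[k] A) : Prop :=
  IsNovikov circ ∧
  (∀ a b c : A, lhd (rhd a c) b = rhd (rhd a b + lhd a b + circ a b) c) ∧
  (∀ a b c : A, rhd a (lhd c b) - lhd (rhd a c) b + lhd (lhd c a) b
      = lhd c (lhd a b + rhd a b + circ a b)) ∧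
  (∀ a b c : A, rhd (rhd a b + lhd a b + circ a b) c - rhd (rhd b a + lhd b a + circ b a) c
      = rhd a (rhd b c) - rhd b (rhd a c)) ∧
  (∀ a b c : A, lhd (lhd a b) c = lhd (lhd a c) b) ∧
  (∀ a b c : A, circ (rhd a b) c - rhd a (circ b c) = circ (lhd b a) c - circ b (rhd a c)) ∧
  (∀ a b c : A, lhd (circ b c) a - circ b (lhd c a) = lhd (circ c b) a - circ c (lhd b a)) ∧
  (∀ a b c : A, circ (rhd a b) c = circ (rhd a c) b) ∧
  (∀ a b c : A, lhd (circ a b) c = circ (lhd a c) b)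

/-- Rota-Baxter operator of weight `lam` on the Novikov algebra `(A, mulA)`. -/
def IsRotaBaxter (mulA : A →ₗ[k] A →ₗ[k] A) (lam : k) (T : A →ₗ[k] A) : Prop :=
  ∀ x y : A, mulA (T x) (T y) = T (mulA (T x) y + mulA x (T y) + lam • mulA x y)

/-- `β : M → A` is balanced. -/
def IsBalanced (l r : A →ₗ[k] Module.End k M) (β : M →ₗ[k] A) : Prop :=
  ∀ u v : M, l (β u) v = r (β v) u

/-- `β : M → A` is A-invariant of mass `κ`. -/
def IsAInvariant (mulA : A →ₗ[k] A →ₗ[k] A) (l r : A →ₗ[k] Module.End k M)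
    (κ : k) (β : M →ₗ[k] A) : Prop :=
  (∀ (x : A) (u : M), κ • mulA x (β u) = κ • β (l x u)) ∧
  (∀ (x : A) (u : M), κ • mulA (β u) x = κ • β (r x u))

/-- `β : M → A` is equivalent of mass `μ`. -/
def IsEquivalentOfMass (mulM : M →ₗ[k] M →ₗ[k] M) (l r : A →ₗ[k] Module.End k M)
    (μ : k) (β : M →ₗ[k] A) : Prop :=
  (∀ u v w : M, μ • l (β (mulM u v)) w = μ • mulM (l (β u) v) w) ∧
  (∀ u v w : M, μ • r (β (mulM v w)) u = μ • mulM u (r (β w) v))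

/-- `β : M → A` is an A-bimodule homomorphism from `(M, l, r)` to `(A, L_A, R_A)`. -/
def IsBimoduleHom (mulA : A →ₗ[k] A →ₗ[k] A) (l r : A →ₗ[k] Module.End k M)
    (β : M →ₗ[k] A) : Prop :=
  (∀ (x : A) (u : M), β (l x u) = mulA x (β u)) ∧
  (∀ (x : A) (u : M), β (r x u) = mulA (β u) x)

/-- Extended O-operator of weight `lam` with extension `β` of mass `(κ, μ)`. -/
def IsExtendedOOperator (mulA : A →ₗ[k] A →ₗ[k] A) (mulM : M →ₗ[k] M →ₗ[k] M)
    (l r : A →ₗ[k] Module.End k M) (lam κ μ : k) (α β : M →ₗ[k] A) : Prop :=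
  IsBalanced l r β ∧ IsAInvariant mulA l r κ β ∧ IsEquivalentOfMass mulM l r μ β ∧
  ∀ u v : M, mulA (α u) (α v) - α (l (α u) v + r (α v) u + lam • mulM u v)
    = κ • mulA (β u) (β v) + μ • β (mulM u v)

end Defs

section DualDefs
variable {k : Type*} [Field k] [CharZero k]
variable {A : Type*} [AddCommGroup A] [Module k A]
variable {M : Type*} [AddCommGroup M] [Module k M]

/-- The dual representation `φ*` of `φ : A → End M`, with `⟨φ*(a) f, v⟩ = −⟨f, φ(a) v⟩`. -/
noncomputable def dualRep (φ : A →ₗ[k] Module.End k M) :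
    A →ₗ[k] Module.End k (Module.Dual k M) :=
  (Module.Dual.transpose (R := k)) ∘ₗ (-φ)


/-- The negative `−φ*` of the dual representation, i.e. `a ↦ (f ↦ f ∘ φ(a))`;
for `φ = R` this is the action `−R*`. -/
noncomputable def negDualRep (φ : A →ₗ[k] Module.End k M) :
    A →ₗ[k] Module.End k (Module.Dual k M) :=
  (Module.Dual.transpose (R := k)) ∘ₗ φ

/-- The linear map `A ⊗ A → Hom(A*, A)`, `x ⊗ y ↦ (f ↦ f(x) • y)`, sending `r` to `r̂`. -/
noncomputable def hatMap : A ⊗[k] A →ₗ[k] (Module.Dual k A →ₗ[k] A) :=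
  TensorProduct.lift
    (LinearMap.mk₂ k (fun x y => LinearMap.smulRight (Module.Dual.eval k A x) y)
      (fun x x' y => by
        ext f
        simp only [LinearMap.smulRight_apply, Module.Dual.eval_apply, LinearMap.add_apply,
          map_add, add_smul])
      (fun c x y => by
        ext f
        simp only [LinearMap.smulRight_apply, Module.Dual.eval_apply, LinearMap.smul_apply,
          map_smul, smul_assoc])
      (fun x y y' => by
        ext f
        simp only [LinearMap.smulRight_apply, Module.Dual.eval_apply, LinearMap.add_apply,
          smul_add])
      (fun c x y => by
        ext f
        exact smul_comm _ _ _))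

/-- `s ∈ A ⊗ A` is invariant: `(L(x) ⊗ id + id ⊗ L⋆(x)) s = 0` for all `x ∈ A`. -/
def IsInvariantTensor (mulA : A →ₗ[k] A →ₗ[k] A) (s : A ⊗[k] A) : Prop :=
  ∀ x : A, TensorProduct.map (mulA x) LinearMap.id s
      + TensorProduct.map LinearMap.id ((mulA + mulA.flip) x) s = 0

/-- The bilinear operation sending `(r, r')` to `r₁₃ ∘ r'₂₃ = Σ xᵢ ⊗ x'ⱼ ⊗ (yᵢ ∘ y'ⱼ)`. -/
noncomputable def t1323 (m : A →ₗ[k] A →ₗ[k] A) :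
    (A ⊗[k] A) ⊗[k] (A ⊗[k] A) →ₗ[k] (A ⊗[k] A) ⊗[k] A :=
  TensorProduct.map LinearMap.id (TensorProduct.lift m) ∘ₗ
    (TensorProduct.tensorTensorTensorComm k A A A A).toLinearMap

/-- The bilinear operation sending `(r, r')` to `r₁₂ m r'₂₃ = Σ xᵢ ⊗ (yᵢ m x'ⱼ) ⊗ y'ⱼ`. -/
noncomputable def t1223 (m : A →ₗ[k] A →ₗ[k] A) :
    (A ⊗[k] A) ⊗[k] (A ⊗[k] A) →ₗ[k] (A ⊗[k] A) ⊗[k] A :=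
  (TensorProduct.assoc k A A A).symm.toLinearMap ∘ₗ
  TensorProduct.map LinearMap.id
    (TensorProduct.map (TensorProduct.lift m) LinearMap.id ∘ₗ
      (TensorProduct.assoc k A A A).symm.toLinearMap) ∘ₗ
  (TensorProduct.assoc k A A (A ⊗[k] A)).toLinearMap

/-- The bilinear operation sending `(r, r')` to `r₁₃ ∘ r'₁₂ = Σ (xᵢ ∘ x'ⱼ) ⊗ y'ⱼ ⊗ yᵢ`. -/
noncomputable def t1312 (m : A →ₗ[k] A →ₗ[k] A) :
    (A ⊗[k] A) ⊗[k] (A ⊗[k] A) →ₗ[k] (A ⊗[k] A) ⊗[k] A :=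
  (TensorProduct.assoc k A A A).symm.toLinearMap ∘ₗ
  TensorProduct.map (TensorProduct.lift m) (TensorProduct.comm k A A).toLinearMap ∘ₗ
  (TensorProduct.tensorTensorTensorComm k A A A A).toLinearMap

/-- `r₁₃∘r₂₃ + r₁₂⋆r₂₃ + r₁₃∘r₁₂` as an element of `A ⊗ A ⊗ A` (grouping `(A ⊗ A) ⊗ A`). -/
noncomputable def nybeLHS (mulA : A →ₗ[k] A →ₗ[k] A) (r : A ⊗[k] A) : (A ⊗[k] A) ⊗[k] A :=
  t1323 mulA (r ⊗ₜ[k] r) + t1223 (mulA + mulA.flip) (r ⊗ₜ[k] r) + t1312 mulA (r ⊗ₜ[k] r)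

/-- `r` is a solution of the Novikov Yang–Baxter equation in `A`. -/
def IsNYBESolution (mulA : A →ₗ[k] A →ₗ[k] A) (r : A ⊗[k] A) : Prop :=
  nybeLHS mulA r = 0

/-- `r` is a solution of the extended Novikov Yang–Baxter equation of mass `ε` in `A`. -/
def IsENYBESolution (mulA : A →ₗ[k] A →ₗ[k] A) (ε : k) (r : A ⊗[k] A) : Prop :=
  nybeLHS mulA r
    = ε • t1323 mulA ((r + TensorProduct.comm k A A r) ⊗ₜ[k] (r + TensorProduct.comm k A A r))

end DualDefs

section Contraction
variable {k : Type*} [Field k] {A : Type*} [AddCommGroup A] [Module k A]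

/-- Contraction of the first two tensor factors against `a` and `b`. -/
noncomputable def contractFirstTwo (a b : Module.Dual k A) : (A ⊗[k] A) ⊗[k] A →ₗ[k] A :=
  (TensorProduct.lid k A).toLinearMap ∘ₗ
    LinearMap.rTensor A (TensorProduct.dualDistrib k A A (a ⊗ₜ[k] b))

theorem contractFirstTwo_tmul (a b : Module.Dual k A) (x y z : A) :
    contractFirstTwo a b ((x ⊗ₜ[k] y) ⊗ₜ[k] z) = (a x * b y) • z := by
  simp [contractFirstTwo]

theorem eq_zero_of_contractFirstTwo [FiniteDimensional k A] (t : (A ⊗[k] A) ⊗[k] A)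
    (h : ∀ a b : Module.Dual k A, contractFirstTwo a b t = 0) : t = 0 := by
  let B := Module.finBasis k A
  apply (TensorProduct.equivFinsuppOfBasisLeft (N := A) (B.tensorProduct B)).injective
  rw [map_zero]
  ext ⟨i, j⟩
  have hc : (B.tensorProduct B).coord (i, j)
      = TensorProduct.dualDistrib k A A (B.coord i ⊗ₜ[k] B.coord j) := by
    ext x y
    simp [mul_comm]
  rw [TensorProduct.equivFinsuppOfBasisLeft_apply, hc]
  exact h _ _

theorem hatMap_tmul (x y : A) (f : Module.Dual k A) :
    hatMap (x ⊗ₜ[k] y) f = f x • y := rfl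

theorem dualRep_apply (φ : A →ₗ[k] Module.End k A) (x y : A) (f : Module.Dual k A) :
    dualRep φ x f y = -f (φ x y) := by
  simp [dualRep, Module.Dual.transpose_apply]

theorem contractFirstTwo_t1323 (m : A →ₗ[k] A →ₗ[k] A) (a b : Module.Dual k A) (r s : A ⊗[k] A) :
    contractFirstTwo a b (t1323 m (r ⊗ₜ[k] s)) = m (hatMap r a) (hatMap s b) := by
  induction r with
  | zero => simp
  | add r₁ r₂ h₁ h₂ => simp only [TensorProduct.add_tmul, map_add, LinearMap.add_apply, h₁, h₂]
  | tmul x y =>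
    induction s with
    | zero => simp
    | add s₁ s₂ h₁ h₂ => simp only [TensorProduct.tmul_add, map_add, LinearMap.add_apply, h₁, h₂]
    | tmul z w =>
      simp [t1323, contractFirstTwo_tmul, hatMap_tmul, smul_smul, mul_comm]

theorem contractFirstTwo_t1223 (m : A →ₗ[k] A →ₗ[k] A) (a b : Module.Dual k A) (r s : A ⊗[k] A) :
    contractFirstTwo a b (t1223 m (r ⊗ₜ[k] s)) = -hatMap s (dualRep m (hatMap r a) b) := by
  induction r with
  | zero => simp
  | add r₁ r₂ h₁ h₂ =>
    simp only [TensorProduct.add_tmul, map_add, LinearMap.add_apply, h₁, h₂, neg_add]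
  | tmul x y =>
    induction s with
    | zero => simp
    | add s₁ s₂ h₁ h₂ =>
      simp only [TensorProduct.tmul_add, map_add, LinearMap.add_apply, h₁, h₂, neg_add]
    | tmul z w =>
      simp [t1223, contractFirstTwo_tmul, hatMap_tmul, dualRep_apply, smul_smul]

theorem contractFirstTwo_t1312 (m : A →ₗ[k] A →ₗ[k] A) (a b : Module.Dual k A) (r s : A ⊗[k] A) :
    contractFirstTwo a b (t1312 m (r ⊗ₜ[k] s))
      = -hatMap r (dualRep m.flip (hatMap (TensorProduct.comm k A A s) b) a) := by
  induction r with
  | zero => simp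
  | add r₁ r₂ h₁ h₂ =>
    simp only [TensorProduct.add_tmul, map_add, LinearMap.add_apply, h₁, h₂, neg_add]
  | tmul x y =>
    induction s with
    | zero => simp
    | add s₁ s₂ h₁ h₂ =>
      simp only [TensorProduct.tmul_add, map_add, LinearMap.add_apply, h₁, h₂, neg_add]
    | tmul z w =>
      simp [t1312, contractFirstTwo_tmul, hatMap_tmul, dualRep_apply, smul_smul, mul_comm]

theorem contractFirstTwo_nybeLHS (m : A →ₗ[k] A →ₗ[k] A) (a b : Module.Dual k A) (r : A ⊗[k] A) :
    contractFirstTwo a b (nybeLHS m r) = m (hatMap r a) (hatMap r b)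
      - hatMap r (dualRep (m + m.flip) (hatMap r a) b
          + dualRep m.flip (hatMap (TensorProduct.comm k A A r) b) a) := by
  rw [nybeLHS, map_add, map_add, contractFirstTwo_t1323, contractFirstTwo_t1223,
    contractFirstTwo_t1312, map_add]
  abel

end Contraction

/-- `r` solves the Novikov Yang–Baxter equation iff
`r̂(a*) ∘ r̂(b*) = r̂(L⋆*(r̂(a*))b* + R*(r̂ᵗ(b*))a*)` for all `a*, b* ∈ A*`. -/
theorem nybe_iff_operator_form
    {k : Type*} [Field k] [CharZero k]
    {A : Type*} [AddCommGroup A] [Module k A] [FiniteDimensional k A]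
    (mulA : A →ₗ[k] A →ₗ[k] A) (hA : IsNovikov mulA) (r : A ⊗[k] A) :
    IsNYBESolution mulA r ↔
      ∀ a b : Module.Dual k A,
        mulA (hatMap r a) (hatMap r b)
          = hatMap r (dualRep (mulA + mulA.flip) (hatMap r a) b
              + dualRep mulA.flip (hatMap (TensorProduct.comm k A A r) b) a) := by
  refine ⟨fun h a b => ?_, fun h => eq_zero_of_contractFirstTwo _ fun a b => ?_⟩
  · rw [← sub_eq_zero, ← contractFirstTwo_nybeLHS, show nybeLHS mulA r = 0 from h, map_zero]
  · rw [contractFirstTwo_nybeLHS, h a b, sub_self]
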